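/- There do not exist four vectors ψ_{00}, ψ_{01}, ψ_{10}, ψ_{11} ∈ ℂ⁴ = ℂ² × ℂ² that simultaneously (a) form an orthonormal family and (b) satisfy ψ_{ij} = P₀ ψ_{ik} + P₁ ψ_{k'j} for all i, j, k, k' ∈ {0,1}, where P₀(u,w) = (u,0) and P₁(u,w) = (0,w) are the orthogonal projections onto the two ℂ² summands. Consequently, for the D1Q2 lattice gas with sublinear space encoding and quantum-walk streaming, no encoding of the four classical cell states into orthonormal quantum states is compatible with streaming. -/

import Mathlib

/-- `ℂ⁴` realized as the Hilbert space direct sum `ℂ² × ℂ²`. -/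
abbrev C2C2 : Type := WithLp 2 (EuclideanSpace ℂ (Fin 2) × EuclideanSpace ℂ (Fin 2))

/-- Orthogonal projection onto the first `ℂ²` summand: `P₀ (u, w) = (u, 0)`. -/
noncomputable def projFst (ψ : C2C2) : C2C2 :=
  (WithLp.equiv 2 (EuclideanSpace ℂ (Fin 2) × EuclideanSpace ℂ (Fin 2))).symm
    (((WithLp.equiv 2 (EuclideanSpace ℂ (Fin 2) × EuclideanSpace ℂ (Fin 2))) ψ).1, 0)

/-- Orthogonal projection onto the second `ℂ²` summand: `P₁ (u, w) = (0, w)`. -/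
noncomputable def projSnd (ψ : C2C2) : C2C2 :=
  (WithLp.equiv 2 (EuclideanSpace ℂ (Fin 2) × EuclideanSpace ℂ (Fin 2))).symm
    (0, ((WithLp.equiv 2 (EuclideanSpace ℂ (Fin 2) × EuclideanSpace ℂ (Fin 2))) ψ).2)

/-- **No orthonormal encoding compatible with quantum-walk streaming (D1Q2).**
There do not exist four vectors `ψ_{ij} ∈ ℂ⁴ = ℂ² × ℂ²` (`i j ∈ {0,1}`) that are
simultaneously an orthonormal family and satisfy the post-streaming consistency
condition `ψ_{ij} = P₀ ψ_{ik} + P₁ ψ_{k'j}` for all `i j k k'`. -/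
theorem no_orthonormal_streaming_compatible_encoding :
    ¬ ∃ ψ : Fin 2 → Fin 2 → C2C2,
        Orthonormal ℂ (fun p : Fin 2 × Fin 2 => ψ p.1 p.2) ∧
        ∀ i j k k' : Fin 2, ψ i j = projFst (ψ i k) + projSnd (ψ k' j) := by
  rintro ⟨ψ, ho, h⟩
  have e : ψ 0 0 + ψ 1 1 = ψ 0 1 + ψ 1 0 := by
    rw [h 0 0 0 0, h 1 1 1 1, h 0 1 0 1, h 1 0 1 0]
    abel
  have e2 := congrArg (fun x => inner ℂ (ψ 0 0) x) e
  simp only [inner_add_right] at e2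
  have ho' := orthonormal_iff_ite.mp ho
  have h0 := ho' (0, 0) (0, 0)
  have h1 := ho' (0, 0) (1, 1)
  have h2 := ho' (0, 0) (0, 1)
  have h3 := ho' (0, 0) (1, 0)
  simp only [Prod.mk.injEq, zero_ne_one, and_self, and_true, and_false, if_true, if_false] at h0 h1 h2 h3
  rw [h0, h1, h2, h3] at e2
  norm_num at e2
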